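/- A finite commutative quotient ring R[X]/⟨t(X)⟩ with t monic is a principal ideal ring if and only if its nilradical is a principal ideal. -/

import Mathlib

open Polynomial

lemma pir_of_nil (A : Type*) [CommRing A] [IsArtinianRing A]
    (h : (nilradical A).IsPrincipal) : IsPrincipalIdealRing A := by
  refine IsPrincipalIdealRing.of_prime fun M hM => ?_
  obtain ⟨x, hx⟩ := h
  rw [← Ideal.span] at hx
  obtain ⟨n, hn⟩ := IsArtinian.monotone_stabilizes
    (R := A) (M := A) ⟨fun k => OrderDual.toDual (M ^ k), fun a b hab => Ideal.pow_le_pow_right hab⟩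
  have hn' : ∀ m, n ≤ m → M ^ n = M ^ m := hn
  have hid : IsIdempotentElem (M ^ (n + 1)) := by
    unfold IsIdempotentElem
    rw [← pow_add, ← hn' (n + 1 + (n + 1)) (by omega), ← hn' (n + 1) (by omega)]
  obtain ⟨e, he, hMe⟩ := (Ideal.isIdempotentElem_iff_of_fg _ (IsNoetherian.noetherian _)).1 hid
  have heM : e ∈ M := by
    have : e ∈ M ^ (n + 1) := by rw [hMe]; exact Ideal.mem_span_singleton_self e
    exact Ideal.pow_le_self (by omega) this
  have hxM : x ∈ M := by
    have : x ∈ nilradical A := by rw [hx]; exact Ideal.mem_span_singleton_self x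
    exact nilradical_le_prime M this
  have hee : e * e = e := he
  refine ⟨e + (1 - e) * x, ?_⟩
  rw [← Ideal.span]
  apply le_antisymm
  · intro y hy
    have h1 : y * (1 - e) ∈ nilradical A := by
      refine ⟨n + 1, ?_⟩
      have hyn : y ^ (n + 1) ∈ M ^ (n + 1) := Ideal.pow_mem_pow hy _
      rw [hMe, Ideal.mem_span_singleton'] at hyn
      obtain ⟨a, ha⟩ := hyn
      rw [Submodule.zero_eq_bot, Ideal.mem_bot, mul_pow, ← ha, pow_succ (1 - e)]
      linear_combination (-(a * (1 - e) ^ n)) * hee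
    rw [hx, Ideal.mem_span_singleton'] at h1
    obtain ⟨a, ha⟩ := h1
    rw [Ideal.mem_span_singleton']
    refine ⟨y * e + a * (1 - e), ?_⟩
    linear_combination (y - y * x - a + a * x - a * x + a * x * e - a * x + y + a * x * (2 - e)) * hee + (1 - e) * ha
  · rw [Ideal.span_singleton_le_iff_mem]
    exact M.add_mem heM (M.mul_mem_left _ hxM)

/-- For a finite chain ring `R` and a monic polynomial `t`, the quotient
`R[X]/⟨t⟩` is a principal ideal ring iff its nilradical is principal. -/
theorem quotient_pir_iff_nilradical_principal
    (R : Type*) [CommRing R] [Finite R] [IsLocalRing R]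
    (hprin : (IsLocalRing.maximalIdeal R).IsPrincipal)
    (t : R[X]) (ht : t.Monic) :
    IsPrincipalIdealRing (R[X] ⧸ Ideal.span {t}) ↔
      (nilradical (R[X] ⧸ Ideal.span {t})).IsPrincipal := by
  have : Module.Finite R (R[X] ⧸ Ideal.span {t}) := ht.finite_quotient
  have : Finite (R[X] ⧸ Ideal.span {t}) := Module.finite_of_finite R
  exact ⟨fun h => h.principal _, pir_of_nil _⟩
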